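/- Let (A₁,…,A_k) and (B₁,…,B_k) be two k-tuples of m×n real matrices. There exist real orthogonal matrices U (m×m) and V (n×n) such that UA_iV = B_i for every i = 1,…,k if and only if for every nonempty finite sequence of index pairs (i₁,j₁),…,(i_ℓ,j_ℓ) with entries in {1,…,k}, trace((A_{i₁}ᵀA_{j₁})···(A_{i_ℓ}ᵀA_{j_ℓ})) = trace((B_{i₁}ᵀB_{j₁})···(B_{i_ℓ}ᵀB_{j_ℓ})), where Mᵀ denotes the transpose. -/

import Mathlib

open Matrix

section Character

variable {K R M N : Type*} [Field K] [Ring R] [Algebra K R]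
  [AddCommGroup M] [Module K M] [Module R M] [IsScalarTower K R M]
  [AddCommGroup N] [Module K N] [Module R N] [IsScalarTower K R N]

theorem trace_lsmul_congr (e : M ≃ₗ[R] N) (r : R) :
    LinearMap.trace K M (Algebra.lsmul K K M r) = LinearMap.trace K N (Algebra.lsmul K K N r) := by
  rw [← LinearMap.trace_conj' (Algebra.lsmul K K M r) (e.restrictScalars K)]
  congr 1
  ext x
  simp [LinearEquiv.conj_apply]

theorem trace_lsmul_prod [Module.Finite K M] [Module.Finite K N] (r : R) :
    LinearMap.trace K (M × N) (Algebra.lsmul K K (M × N) r) =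
      LinearMap.trace K M (Algebra.lsmul K K M r) + LinearMap.trace K N (Algebra.lsmul K K N r) := by
  rw [← LinearMap.trace_prodMap']
  rfl

theorem isSemisimpleModule_prod [IsSemisimpleModule R M] [IsSemisimpleModule R N] :
    IsSemisimpleModule R (M × N) := by
  have h₁ : IsSemisimpleModule R (LinearMap.inl R M N).range := .range _
  have h₂ : IsSemisimpleModule R (LinearMap.inr R M N).range := .range _
  have h := IsSemisimpleModule.sup h₁ h₂
  rw [LinearMap.sup_range_inl_inr] at h
  exact .congr Submodule.topEquiv.symm

/-- If two semisimple modules have no nonzero homomorphisms between them, some scalar acts as the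
identity on the first and as zero on the second. -/
theorem exists_smul_eq_fst_of_hom_eq_zero [Module.Finite K M] [Module.Finite K N]
    [IsSemisimpleModule R M] [IsSemisimpleModule R N]
    (hMN : ∀ f : M →ₗ[R] N, f = 0) (hNM : ∀ f : N →ₗ[R] M, f = 0) :
    ∃ r : R, (∀ x : M, r • x = x) ∧ ∀ y : N, r • y = 0 := by
  have : IsSemisimpleModule R (M × N) := isSemisimpleModule_prod
  have : Module.Finite (Module.End R (M × N)) (M × N) :=
    Module.Finite.of_restrictScalars_finite K _ _
  let p : Module.End (Module.End R (M × N)) (M × N) :=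
    { toFun := fun z => (z.1, 0)
      map_add' := by simp
      map_smul' := fun f z => by
        have h₁ := congr($(hNM (.fst R M N ∘ₗ f ∘ₗ .inr R M N)) z.2)
        have h₂ := congr($(hMN (.snd R M N ∘ₗ f ∘ₗ .inl R M N)) z.1)
        have h₃ : f z = f (z.1, 0) + f (0, z.2) := by simp [← map_add]
        simp only [LinearMap.comp_apply, LinearMap.inr_apply, LinearMap.inl_apply,
          LinearMap.fst_apply, LinearMap.snd_apply, LinearMap.zero_apply] at h₁ h₂
        ext <;> simp [h₁, h₂, h₃] }
  obtain ⟨r, hr⟩ := Module.Finite.toModuleEnd_moduleEnd_surjective (R := R) (M := M × N) p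
  refine ⟨r, fun x => ?_, fun y => ?_⟩
  · simpa [p] using congr(($hr (x, 0)).1)
  · simpa [p] using congr(($hr (0, y)).2)

theorem exists_equiv_range_complement [IsSemisimpleModule R M] [IsSemisimpleModule R N]
    (f : M →ₗ[R] N) :
    ∃ (D : Submodule R N), Nonempty (M ≃ₗ[R] f.range × f.ker) ∧ Nonempty (N ≃ₗ[R] f.range × D) := by
  obtain ⟨C, hC⟩ := exists_isCompl f.ker
  obtain ⟨D, hD⟩ := exists_isCompl f.range
  exact ⟨D, ⟨(Submodule.prodEquivOfIsCompl _ _ hC.symm).symm.trans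
    (((Submodule.quotientEquivOfIsCompl _ _ hC).symm.trans f.quotKerEquivRange).prodCongr
      (.refl R _))⟩, ⟨(Submodule.prodEquivOfIsCompl _ _ hD).symm⟩⟩

theorem exists_hom_ne_zero_symm [IsSemisimpleModule R M] [IsSemisimpleModule R N]
    (f : N →ₗ[R] M) (hf : f ≠ 0) : ∃ g : M →ₗ[R] N, g ≠ 0 := by
  obtain ⟨D, ⟨e₁⟩, ⟨e₂⟩⟩ := exists_equiv_range_complement f
  refine ⟨e₁.symm.toLinearMap ∘ₗ .inl R _ _ ∘ₗ .fst R _ _ ∘ₗ e₂.toLinearMap, fun h => hf ?_⟩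
  ext x
  have := congr($h (e₂.symm (⟨f x, x, rfl⟩, 0)))
  simpa [Subtype.ext_iff] using this

end Character

/-- Finite-dimensional semisimple modules in characteristic zero are determined by their
characters. -/
theorem nonempty_linearEquiv_of_trace_eq (K : Type*) {R M N : Type*} [Field K] [CharZero K] [Ring R]
    [Algebra K R] [AddCommGroup M] [Module K M] [Module R M] [IsScalarTower K R M]
    [AddCommGroup N] [Module K N] [Module R N] [IsScalarTower K R N]
    [Module.Finite K M] [Module.Finite K N]
    [IsSemisimpleModule R M] [IsSemisimpleModule R N]
    (h : ∀ r : R, LinearMap.trace K M (Algebra.lsmul K K M r) =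
      LinearMap.trace K N (Algebra.lsmul K K N r)) :
    Nonempty (M ≃ₗ[R] N) := by
  by_cases hM : ∃ f : M →ₗ[R] N, f ≠ 0
  · obtain ⟨f, hf⟩ := hM
    obtain ⟨D, ⟨e₁⟩, ⟨e₂⟩⟩ := exists_equiv_range_complement f
    have hlt : Module.finrank K f.ker < Module.finrank K M := by
      have : (f.restrictScalars K).ker < ⊤ := lt_top_iff_ne_top.2 fun h =>
        hf (LinearMap.ext fun x => by
          have hx : x ∈ (f.restrictScalars K).ker := h ▸ Submodule.mem_top
          simpa using hx)
      exact Submodule.finrank_lt this.ne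
    have : Module.Finite K f.ker := Module.Finite.of_injective (f.ker.subtype.restrictScalars K)
      Subtype.val_injective
    have : Module.Finite K D := Module.Finite.of_injective (D.subtype.restrictScalars K)
      Subtype.val_injective
    have : Module.Finite K f.range :=
      Module.Finite.of_injective (f.range.subtype.restrictScalars K) Subtype.val_injective
    obtain ⟨e⟩ := nonempty_linearEquiv_of_trace_eq K (M := f.ker) (N := D) fun r => by
      have := h r
      rwa [trace_lsmul_congr e₁, trace_lsmul_congr e₂, trace_lsmul_prod, trace_lsmul_prod,
        add_right_inj] at this
    exact ⟨e₁.trans (((LinearEquiv.refl R _).prodCongr e).trans e₂.symm)⟩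
  · have hMN : ∀ f : M →ₗ[R] N, f = 0 := by simpa using hM
    have hNM : ∀ f : N →ₗ[R] M, f = 0 := fun f => by
      by_contra hf
      exact hM (exists_hom_ne_zero_symm f hf)
    obtain ⟨r, hr, hr'⟩ := exists_smul_eq_fst_of_hom_eq_zero (K := K) hMN hNM
    have h₁ := h r
    have h₂ := h 1
    have e₁ : Algebra.lsmul K K M r = 1 := LinearMap.ext hr
    have e₂ : Algebra.lsmul K K N r = 0 := LinearMap.ext hr'
    rw [e₁, e₂, LinearMap.trace_one, map_zero, Nat.cast_eq_zero] at h₁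
    rw [map_one (Algebra.lsmul K K M), map_one (Algebra.lsmul K K N), LinearMap.trace_one,
      LinearMap.trace_one, h₁, Nat.cast_inj] at h₂
    have := Module.finrank_zero_iff.1 h₁
    have := Module.finrank_zero_iff.1 h₂.symm
    exact ⟨0⟩
termination_by Module.finrank K M

open scoped MatrixOrder in
/-- The orthogonal factor in the polar decomposition of an invertible intertwiner of two families
closed under transposition is again an intertwiner. -/
theorem exists_orthogonal_intertwiner {ι n : Type*} [Fintype n] [DecidableEq n] (σ : ι → ι)
    {X Y : ι → Matrix n n ℝ} (hX : ∀ p, X (σ p) = (X p)ᵀ) (hY : ∀ p, Y (σ p) = (Y p)ᵀ)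
    {T : Matrix n n ℝ} (hT : IsUnit T) (h : ∀ p, T * X p = Y p * T) :
    ∃ Q : Matrix n n ℝ, Qᵀ * Q = 1 ∧ ∀ p, Q * X p = Y p * Q := by
  have hpos : (Tᵀ * T).PosDef := by
    have := Matrix.PosDef.conjTranspose_mul_self T
      (Matrix.mulVec_injective_iff_isUnit.2 hT)
    simpa using this
  have h' : ∀ p, X p * Tᵀ = Tᵀ * Y p := fun p => by
    have := congr(($(h (σ p)))ᵀ)
    simpa [hX, hY] using this
  have hcomm : ∀ p, Commute (Tᵀ * T) (X p) := fun p => by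
    rw [Commute, SemiconjBy, mul_assoc, h, ← mul_assoc, ← h', mul_assoc]
  set S := CFC.sqrt (Tᵀ * T) with hS
  have hSS : S * S = Tᵀ * T := CFC.sqrt_mul_sqrt_self _ hpos.posSemidef.nonneg
  have hSt : Sᵀ = S := by
    have : Sᴴ = S := (CFC.sqrt_nonneg (Tᵀ * T)).posSemidef.isHermitian
    simpa using this
  have hSc : ∀ p, Commute S (X p) := fun p => by
    rw [hS, CFC.sqrt_eq_cfc]
    exact (hcomm p).cfc_nnreal _
  have hSu : IsUnit S := by
    have : IsUnit (S * S) := hSS ▸ hpos.isUnit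
    exact isUnit_of_mul_isUnit_left this
  have hdet : IsUnit S.det := (Matrix.isUnit_iff_isUnit_det S).1 hSu
  refine ⟨T * S⁻¹, ?_, fun p => ?_⟩
  · rw [transpose_mul, transpose_nonsing_inv, hSt, mul_assoc, ← mul_assoc Tᵀ, ← hSS,
      mul_assoc, mul_nonsing_inv _ hdet, mul_one, nonsing_inv_mul _ hdet]
  · have : S⁻¹ * X p = X p * S⁻¹ := by
      calc S⁻¹ * X p = S⁻¹ * (X p * S) * S⁻¹ := by
            rw [mul_assoc, mul_assoc, mul_nonsing_inv _ hdet, mul_one]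
        _ = X p * S⁻¹ := by
            rw [← (hSc p).eq, ← mul_assoc, nonsing_inv_mul _ hdet, one_mul]
    rw [mul_assoc, this, ← mul_assoc, h, mul_assoc]

/-- Real matrices with the same Gram matrix differ by an orthogonal left factor. -/
theorem exists_orthogonal_mul_eq_of_gram_eq {m n : Type*} [Fintype m] [DecidableEq m]
    [Fintype n] [DecidableEq n] {C D : Matrix m n ℝ} (h : Cᵀ * C = Dᵀ * D) :
    ∃ U : Matrix m m ℝ, Uᵀ * U = 1 ∧ U * C = D := by
  let c := toEuclideanLin C
  let d := toEuclideanLin D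
  have hn : ∀ x, ‖c x‖ = ‖d x‖ := fun x => by
    have key : ∀ E : Matrix m n ℝ, ‖toEuclideanLin E x‖ ^ 2 = x.ofLp ⬝ᵥ (Eᵀ * E) *ᵥ x.ofLp := by
      intro E
      rw [← real_inner_self_eq_norm_sq, EuclideanSpace.inner_eq_star_dotProduct, toLpLin_apply,
        ← mulVec_mulVec, dotProduct_mulVec, vecMul_transpose]
      simp
    rw [← sq_eq_sq₀ (norm_nonneg _) (norm_nonneg _), key, key, h]
  have hk : c.ker ≤ d.ker := fun x hx => by
    rw [LinearMap.mem_ker] at hx ⊢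
    rw [← norm_eq_zero, ← hn, hx, norm_zero]
  let L : c.range →ₗᵢ[ℝ] EuclideanSpace ℝ m :=
    { toLinearMap := c.ker.liftQ d hk ∘ₗ c.quotKerEquivRange.symm.toLinearMap
      norm_map' := by
        rintro ⟨_, x, rfl⟩
        have : c.quotKerEquivRange.symm ⟨c x, x, rfl⟩ = c.ker.mkQ x := by
          rw [LinearEquiv.symm_apply_eq]; rfl
        simp [this, hn] }
  have hL : ∀ x, L ⟨c x, x, rfl⟩ = d x := fun x => by
    have : c.quotKerEquivRange.symm ⟨c x, x, rfl⟩ = c.ker.mkQ x := by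
      rw [LinearEquiv.symm_apply_eq]; rfl
    simp [L, this]
  refine ⟨toEuclideanLin.symm L.extend.toLinearMap, ?_, ?_⟩
  · apply toEuclideanLin.injective
    rw [toLpLin_mul 2 2 2, ← conjTranspose_eq_transpose_of_trivial,
      toEuclideanLin_conjTranspose_eq_adjoint, LinearEquiv.apply_symm_apply, toLpLin_one]
    refine LinearMap.ext fun x => ext_inner_right ℝ fun y => ?_
    simp
  · apply toEuclideanLin.injective
    rw [toLpLin_mul 2 2 2, LinearEquiv.apply_symm_apply]
    refine LinearMap.ext fun x => ?_
    exact (L.extend_apply ⟨c x, x, rfl⟩).trans (hL x)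

section Words

/-- The representation of the free monoid on `ι` by words in a family of matrices. -/
noncomputable def wordRep {ι n : Type*} [Fintype n] [DecidableEq n] (X : ι → Matrix n n ℝ) :
    Representation ℝ (FreeMonoid ι) (n → ℝ) :=
  FreeMonoid.lift fun p => Matrix.toLin' (X p)

variable {ι n : Type*} [Fintype n] [DecidableEq n]

theorem wordRep_of (X : ι → Matrix n n ℝ) (p : ι) :
    wordRep X (.of p) = Matrix.toLin' (X p) := by simp [wordRep]

theorem wordRep_apply (X : ι → Matrix n n ℝ) (w : FreeMonoid ι) :
    wordRep X w = Matrix.toLin' ((w.toList.map X).prod) := by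
  induction w using FreeMonoid.inductionOn' with
  | one => simp; rfl
  | of_mul p w ih => rw [map_mul, ih, wordRep_of]; simp [Matrix.toLin'_mul]; rfl

theorem wordRep_isSemisimple (σ : ι → ι) {X : ι → Matrix n n ℝ} (hX : ∀ p, X (σ p) = (X p)ᵀ) :
    IsSemisimpleModule (MonoidAlgebra ℝ (FreeMonoid ι)) (wordRep X).asModule := by
  rw [← Representation.isSemisimpleRepresentation_iff_isSemisimpleModule_asModule]
  refine ⟨fun W => ?_⟩
  let B : LinearMap.BilinForm ℝ (n → ℝ) := dotProductBilin ℝ ℝ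
  have hc : IsCompl W.toSubmodule (B.orthogonal W.toSubmodule) := by
    rw [LinearMap.BilinForm.isCompl_orthogonal_iff_disjoint
      fun x y h => (dotProduct_comm y x).trans h, Submodule.disjoint_def]
    exact fun x hx hx' => dotProduct_self_eq_zero.1 (hx' x hx)
  have hinv : ∀ w, ∀ v ∈ B.orthogonal W.toSubmodule,
      wordRep X w v ∈ B.orthogonal W.toSubmodule := by
    intro w
    induction w using FreeMonoid.inductionOn' with
    | one => simp
    | of_mul p w ih =>
      intro v hv u hu
      have h₁ := W.apply_mem_toSubmodule (.of (σ p)) hu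
      have h₂ := ih v hv _ h₁
      rw [map_mul, Module.End.mul_apply, wordRep_of]
      rw [wordRep_of] at h₂
      rw [← h₂]
      change u ⬝ᵥ X p *ᵥ _ = (X (σ p) *ᵥ u) ⬝ᵥ _
      rw [hX, mulVec_transpose, dotProduct_mulVec]
  refine ⟨⟨B.orthogonal W.toSubmodule, hinv⟩, ?_⟩
  rw [isCompl_iff, disjoint_iff, codisjoint_iff]
  constructor <;> apply Subrepresentation.toSubmodule_injective
  · exact hc.inf_eq_bot
  · exact hc.sup_eq_top

theorem trace_lsmul_wordRep_eq {X Y : ι → Matrix n n ℝ}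
    (h : ∀ w : List ι, ((w.map X).prod).trace = ((w.map Y).prod).trace)
    (r : MonoidAlgebra ℝ (FreeMonoid ι)) :
    LinearMap.trace ℝ _ (Algebra.lsmul ℝ ℝ (wordRep X).asModule r) =
      LinearMap.trace ℝ _ (Algebra.lsmul ℝ ℝ (wordRep Y).asModule r) := by
  have key : ∀ Z : ι → Matrix n n ℝ, LinearMap.trace ℝ _ (Algebra.lsmul ℝ ℝ (wordRep Z).asModule r)
      = LinearMap.trace ℝ _ ((wordRep Z).asAlgebraHom r) := fun Z => rfl
  rw [key, key]
  clear key
  induction r using MonoidAlgebra.induction_linear with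
  | zero => simp
  | add f g hf hg => simp_all
  | single w c => simp [wordRep_apply, h, Matrix.trace_toLin'_eq]

/-- Two families of real matrices closed under transposition whose words have equal traces are
simultaneously similar. -/
theorem exists_isUnit_intertwiner (σ : ι → ι) {X Y : ι → Matrix n n ℝ}
    (hX : ∀ p, X (σ p) = (X p)ᵀ) (hY : ∀ p, Y (σ p) = (Y p)ᵀ)
    (h : ∀ w : List ι, ((w.map X).prod).trace = ((w.map Y).prod).trace) :
    ∃ T : Matrix n n ℝ, IsUnit T ∧ ∀ p, T * X p = Y p * T := by
  have := wordRep_isSemisimple σ hX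
  have := wordRep_isSemisimple σ hY
  obtain ⟨e⟩ := nonempty_linearEquiv_of_trace_eq ℝ
    (M := (wordRep X).asModule) (N := (wordRep Y).asModule) (trace_lsmul_wordRep_eq h)
  let e' : (n → ℝ) ≃ₗ[ℝ] (n → ℝ) :=
    (wordRep X).asModuleEquiv.symm.trans ((e.restrictScalars ℝ).trans (wordRep Y).asModuleEquiv)
  refine ⟨LinearMap.toMatrix' e'.toLinearMap, ?_, fun p => ?_⟩
  · rw [isUnit_iff_exists_inv]
    refine ⟨LinearMap.toMatrix' e'.symm.toLinearMap, ?_⟩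
    rw [← LinearMap.toMatrix'_comp]
    simp
  · apply Matrix.toLin'.injective
    rw [Matrix.toLin'_mul, Matrix.toLin'_mul, Matrix.toLin'_toMatrix', ← wordRep_of, ← wordRep_of]
    refine LinearMap.ext fun x => ?_
    change (wordRep Y).asModuleEquiv (e ((wordRep X).asModuleEquiv.symm (wordRep X (.of p) x))) =
      wordRep Y (.of p) ((wordRep Y).asModuleEquiv (e ((wordRep X).asModuleEquiv.symm x)))
    rw [Representation.asModuleEquiv_symm_map_rho, map_smul, Representation.asModuleEquiv_map_smul,
      Representation.asAlgebraHom_of]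

end Words

theorem prod_map_eq_conj {ι n : Type*} [Fintype n] [DecidableEq n] {X Y : ι → Matrix n n ℝ}
    {V : Matrix n n ℝ} (hV : Vᵀ * V = 1) (h : ∀ p, Y p = Vᵀ * X p * V) (w : List ι) :
    (w.map Y).prod = Vᵀ * (w.map X).prod * V := by
  induction w with
  | nil => simp [hV]
  | cons p w ih =>
    calc ((p :: w).map Y).prod = Vᵀ * X p * (V * Vᵀ) * (w.map X).prod * V := by
          simp only [List.map_cons, List.prod_cons, ih, h, mul_assoc]
      _ = Vᵀ * ((p :: w).map X).prod * V := by
          rw [mul_eq_one_comm.1 hV]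
          simp only [List.map_cons, List.prod_cons, mul_assoc, one_mul]

/-- A family version of `exists_orthogonal_mul_eq_of_gram_eq`. -/
theorem exists_orthogonal_forall_mul_eq_of_gram_eq {ι m n : Type*} [Fintype ι] [DecidableEq ι]
    [Fintype m] [DecidableEq m] [Fintype n] [DecidableEq n] {C D : ι → Matrix m n ℝ}
    (h : ∀ i j, (C i)ᵀ * C j = (D i)ᵀ * D j) :
    ∃ U : Matrix m m ℝ, Uᵀ * U = 1 ∧ ∀ i, U * C i = D i := by
  obtain ⟨U, hU, hUC⟩ := exists_orthogonal_mul_eq_of_gram_eq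
    (C := .of fun a (q : ι × n) => C q.1 a q.2) (D := .of fun a (q : ι × n) => D q.1 a q.2) <| by
      ext p q
      exact congr($(h p.1 q.1) p.2 q.2)
  refine ⟨U, hU, fun i => ?_⟩
  ext a b
  exact congr($hUC a (i, b))

/-- **Simultaneous real orthogonal equivalence criterion** (Jing, real case).
Two `k`-tuples `(A₁, …, A_k)` and `(B₁, …, B_k)` of `m × n` real matrices satisfy
`U * Aᵢ * V = Bᵢ` for some real orthogonal `U` (of size `m × m`) and `V` (of size `n × n`)
iff `trace ((A_{i₁}ᵀA_{j₁}) ⋯ (A_{i_ℓ}ᵀA_{j_ℓ})) = trace ((B_{i₁}ᵀB_{j₁}) ⋯ (B_{i_ℓ}ᵀB_{j_ℓ}))`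
for every nonempty finite sequence of index pairs, encoded as a nonempty list of pairs
`(i, j)`. -/
theorem simultaneous_real_orthogonal_equivalence (m n k : ℕ)
    (A B : Fin k → Matrix (Fin m) (Fin n) ℝ) :
    (∃ (U : Matrix (Fin m) (Fin m) ℝ) (V : Matrix (Fin n) (Fin n) ℝ),
      Uᵀ * U = 1 ∧ Vᵀ * V = 1 ∧ ∀ i : Fin k, U * A i * V = B i) ↔
    (∀ w : List (Fin k × Fin k), w ≠ [] →
      ((w.map fun p => (A p.1)ᵀ * A p.2).prod).trace =
      ((w.map fun p => (B p.1)ᵀ * B p.2).prod).trace) := by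
  constructor
  · rintro ⟨U, V, hU, hV, h⟩ w -
    have hconj : ∀ p : Fin k × Fin k,
        (B p.1)ᵀ * B p.2 = Vᵀ * ((A p.1)ᵀ * A p.2) * V := fun p => by
      calc (B p.1)ᵀ * B p.2 = Vᵀ * ((A p.1)ᵀ * (Uᵀ * U) * A p.2) * V := by
            simp only [← h, transpose_mul, Matrix.mul_assoc]
        _ = Vᵀ * ((A p.1)ᵀ * A p.2) * V := by rw [hU, Matrix.mul_one]
    rw [prod_map_eq_conj hV hconj, trace_mul_comm, ← mul_assoc, mul_eq_one_comm.1 hV, one_mul]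
  · intro h
    obtain ⟨T, hT, hTX⟩ := exists_isUnit_intertwiner Prod.swap
      (X := fun p : Fin k × Fin k => (A p.1)ᵀ * A p.2) (Y := fun p => (B p.1)ᵀ * B p.2)
      (by simp) (by simp) fun w => by
        rcases eq_or_ne w [] with rfl | hw
        · simp
        · exact h w hw
    obtain ⟨Q, hQ, hQX⟩ := exists_orthogonal_intertwiner Prod.swap (by simp) (by simp) hT hTX
    have hQ' := mul_eq_one_comm.1 hQ
    obtain ⟨U, hU, hUA⟩ := exists_orthogonal_forall_mul_eq_of_gram_eq
      (C := fun i => A i * Qᵀ) (D := B) fun i j => by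
        calc (A i * Qᵀ)ᵀ * (A j * Qᵀ) = Q * ((A i)ᵀ * A j) * Qᵀ := by
              simp only [transpose_mul, transpose_transpose, Matrix.mul_assoc]
          _ = (B i)ᵀ * B j := by rw [hQX (i, j), mul_assoc, hQ', mul_one]
    exact ⟨U, Qᵀ, hU, by rwa [transpose_transpose], fun i => by rw [Matrix.mul_assoc, hUA]⟩
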